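/- arXiv:1312.2570 — 2 statements merged into one kernel-verified Lean document; each statement's English description precedes it below -/
import Mathlib

section
/- Let β ≥ 2 and s ≥ 1, and let u, v be positive integers with gcd(v, β) = 1. Suppose u = β^q·u' where 0 ≤ q ≤ s and gcd(u', β) = 1. Then (u/v) mod β^s = β^q · ((u'/v) mod β^{s−q}); that is, if y < β^{s−q} is the unique natural number with v·y ≡ u' (mod β^{s−q}), then β^q·y is the unique natural number x < β^s with v·x ≡ u (mod β^s). -/
/-- **Reduction of the modular division to the case `gcd(u, β) = 1`.**
For `β ≥ 2`, `s ≥ 1`, positive `u, v` with `gcd(v, β) = 1`, if `u = β^q·u'`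
with `q ≤ s` and `gcd(u', β) = 1`, then `(u/v) mod β^s = β^q·((u'/v) mod β^{s−q})`:
if `y < β^{s−q}` is the unique natural with `v·y ≡ u' (mod β^{s−q})`, then
`β^q·y` is the unique natural `x < β^s` with `v·x ≡ u (mod β^s)`. -/
theorem modular_quotient_shift (β s u v u' q : ℕ) (hβ : 2 ≤ β) (hs : 1 ≤ s)
    (hu : 0 < u) (hv : 0 < v) (hgcd : Nat.gcd v β = 1)
    (hq : q ≤ s) (huq : u = β ^ q * u') (hgcdu' : Nat.gcd u' β = 1)
    (y : ℕ) (hy : y < β ^ (s - q)) (hvy : v * y ≡ u' [MOD β ^ (s - q)]) :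
    β ^ q * y < β ^ s ∧ v * (β ^ q * y) ≡ u [MOD β ^ s] ∧
    ∀ x : ℕ, x < β ^ s → v * x ≡ u [MOD β ^ s] → x = β ^ q * y := by
  have hpow : β ^ s = β ^ q * β ^ (s - q) := by
    rw [← pow_add, Nat.add_sub_cancel' hq]
  have hlt : β ^ q * y < β ^ s := by
    rw [hpow]
    exact Nat.mul_lt_mul_of_pos_left hy (by positivity)
  have hmod : v * (β ^ q * y) ≡ u [MOD β ^ s] := by
    rw [hpow, huq, Nat.mul_left_comm]
    exact Nat.ModEq.mul_left' _ hvy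
  refine ⟨hlt, hmod, fun x hx hvx => ?_⟩
  have hcop : Nat.gcd (β ^ s) v = 1 := (Nat.Coprime.pow_right s hgcd).symm
  exact (Nat.ModEq.cancel_left_of_coprime hcop (hvx.trans hmod.symm)).eq_of_lt_of_lt hx hlt
end

section
/- Let β ≥ 2 and let u, v be positive integers with gcd(v, β) = 1, ℓ_β(u) = s, ℓ_β(v) = t and s ≥ t. Set r = s − t + 1 and let x < β^r be the unique natural number with v·x ≡ u (mod β^r). Then β^r divides |x·v − u| (the absolute value taken in ℤ), and the digit modulus dmod_β(u, v) = |x·v − u| / β^r satisfies dmod_β(u, v) < β^t. -/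
/-- `ell β n` is the number of base-`β` digits of `n`: for `n ≥ 1` and `β ≥ 2`
it equals `⌊log_β n⌋ + 1`, the least `t` with `n < β^t`. -/
def ell (β n : ℕ) : ℕ := Nat.log β n + 1

/-- **Well-definedness and bound for the digit modulus (dmod) operation.**
For `β ≥ 2`, positive `u, v` with `gcd(v, β) = 1`, `ℓ_β(u) = s`, `ℓ_β(v) = t`,
`s ≥ t`, `r = s − t + 1`, and `x < β^r` the unique natural with
`v·x ≡ u (mod β^r)`: `β^r` divides `|x·v − u|` (absolute value in `ℤ`), and
`dmod_β(u, v) = |x·v − u| / β^r` satisfies `dmod_β(u, v) < β^t`. -/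
theorem dmod_bound (β u v s t r x : ℕ) (hβ : 2 ≤ β)
    (hu : 0 < u) (hv : 0 < v) (hgcd : Nat.gcd v β = 1)
    (hs : ell β u = s) (ht : ell β v = t) (hst : t ≤ s)
    (hr : r = s - t + 1) (hx : x < β ^ r) (hvx : v * x ≡ u [MOD β ^ r]) :
    ((β : ℤ) ^ r ∣ |(x : ℤ) * v - u|) ∧
    |(x : ℤ) * v - u| / (β : ℤ) ^ r < (β : ℤ) ^ t := by
  have hpos : (0 : ℤ) < (β : ℤ) ^ r := by positivity
  have hu_lt : u < β ^ s := hs ▸ Nat.lt_pow_succ_log_self hβ u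
  have hv_lt : v < β ^ t := ht ▸ Nat.lt_pow_succ_log_self hβ v
  have hu_lt' : u < β ^ t * β ^ r := by
    rw [← pow_add]
    exact hu_lt.trans_le (Nat.pow_le_pow_right (by omega) (by omega))
  have hxv_lt : x * v < β ^ t * β ^ r := by
    rw [mul_comm x v]
    exact Nat.mul_lt_mul'' hv_lt hx
  constructor
  · rw [dvd_abs]
    have h := hvx.symm.dvd
    push_cast at h
    rwa [mul_comm (v : ℤ)] at h
  · apply Int.ediv_lt_of_lt_mul hpos
    zify at hu_lt' hxv_lt
    have hxv_nonneg : (0 : ℤ) ≤ (x : ℤ) * v := by positivity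
    rw [abs_lt]
    constructor <;> linarith [Int.natCast_nonneg u]
end
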